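/- Let (z₁, z₂) be a centered bivariate Gaussian random vector with Var(z₁) = σ₁², Var(z₂) = σ₂² (σ₁, σ₂ > 0) and correlation ρ ∈ [−1, 1], i.e., Cov(z₁,z₂) = ρσ₁σ₂. Then E[max(0, z₁) · max(0, z₂)] = (σ₁σ₂ / (2π)) · ( sin(arccos ρ) + (π − arccos ρ)·ρ ). -/

import Mathlib

open MeasureTheory ProbabilityTheory Real

/-- A finite measure on `ℝ²` is determined by the laws of the linear functionals. -/
lemma measure_fin_two_ext_of_map_linear {μ ν : Measure (Fin 2 → ℝ)}
    [IsFiniteMeasure μ] [IsFiniteMeasure ν]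
    (h : ∀ a b : ℝ, μ.map (fun z => a * z 0 + b * z 1) = ν.map (fun z => a * z 0 + b * z 1)) :
    μ = ν := by
  refine Measure.ext_of_charFunDual (funext fun L => ?_)
  have hL : (L : (Fin 2 → ℝ) → ℝ)
      = fun z => L (Pi.single 0 1) * z 0 + L (Pi.single 1 1) * z 1 := by
    ext z
    have hz : z = z 0 • Pi.single 0 1 + z 1 • Pi.single 1 1 := by
      ext i; fin_cases i <;> simp
    conv_lhs => rw [hz]
    rw [map_add, map_smul, map_smul, smul_eq_mul, smul_eq_mul]
    ring
  rw [charFunDual_eq_charFun_map_one, charFunDual_eq_charFun_map_one, hL, h]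

lemma map_linear_prod_gaussianReal (c s : ℝ) :
    ((gaussianReal 0 1).prod (gaussianReal 0 1)).map (fun p : ℝ × ℝ => c * p.1 + s * p.2)
      = gaussianReal 0 (Real.toNNReal (c ^ 2 + s ^ 2)) := by
  have hmul (c : ℝ) : (gaussianReal 0 1).map (fun x => c * x)
      = gaussianReal 0 (Real.toNNReal (c ^ 2)) := by
    rw [gaussianReal_map_const_mul, mul_zero, mul_one,
      Real.toNNReal_of_nonneg (sq_nonneg c)]
  have hfst : ((gaussianReal 0 1).prod (gaussianReal 0 1)).map (fun p : ℝ × ℝ => c * p.1)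
      = gaussianReal 0 (Real.toNNReal (c ^ 2)) := by
    rw [← hmul, ← (measurePreserving_fst (μ := gaussianReal 0 1) (ν := gaussianReal 0 1)).map_eq,
      Measure.map_map (by fun_prop) (by fun_prop), measurePreserving_fst.map_eq]
    rfl
  have hsnd : ((gaussianReal 0 1).prod (gaussianReal 0 1)).map (fun p : ℝ × ℝ => s * p.2)
      = gaussianReal 0 (Real.toNNReal (s ^ 2)) := by
    rw [← hmul, ← (measurePreserving_snd (μ := gaussianReal 0 1) (ν := gaussianReal 0 1)).map_eq,
      Measure.map_map (by fun_prop) (by fun_prop), measurePreserving_snd.map_eq]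
    rfl
  have hind : IndepFun (fun p : ℝ × ℝ => c * p.1) (fun p : ℝ × ℝ => s * p.2)
      ((gaussianReal 0 1).prod (gaussianReal 0 1)) :=
    indepFun_prod (X := fun x => c * x) (Y := fun x => s * x) (by fun_prop) (by fun_prop)
  have h := gaussianReal_add_gaussianReal_of_indepFun hind hfst hsnd
  rw [add_zero, ← Real.toNNReal_add (sq_nonneg c) (sq_nonneg s)] at h
  exact h

lemma integral_prod_gaussianReal (f : ℝ × ℝ → ℝ) :
    ∫ p, f p ∂(gaussianReal 0 1).prod (gaussianReal 0 1)
      = ∫ p : ℝ × ℝ, (2 * π)⁻¹ * rexp (-(p.1 ^ 2 + p.2 ^ 2) / 2) * f p := by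
  have hmeas : Measurable fun z : ℝ × ℝ => gaussianPDF 0 1 z.1 * gaussianPDF 0 1 z.2 :=
    ((measurable_gaussianPDF _ _).comp measurable_fst).mul
      ((measurable_gaussianPDF _ _).comp measurable_snd)
  rw [gaussianReal_of_var_ne_zero 0 one_ne_zero,
    prod_withDensity (measurable_gaussianPDF _ _) (measurable_gaussianPDF _ _),
    integral_withDensity_eq_integral_toReal_smul hmeas
      (ae_of_all _ fun _ => ENNReal.mul_lt_top gaussianPDF_lt_top gaussianPDF_lt_top)]
  refine integral_congr_ae (ae_of_all _ fun p => ?_)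
  have h2 : (√(2 * π))⁻¹ * (√(2 * π))⁻¹ = (2 * π)⁻¹ := by
    rw [← mul_inv, Real.mul_self_sqrt (by positivity)]
  simp only [ENNReal.toReal_mul, toReal_gaussianPDF, gaussianPDFReal_def,
    smul_eq_mul, NNReal.coe_one, mul_one, sub_zero]
  rw [mul_mul_mul_comm, h2, ← Real.exp_add]
  ring_nf

lemma integral_pow_three_mul_exp_neg_sq_div_two :
    ∫ r in Set.Ioi (0 : ℝ), r ^ 3 * rexp (-r ^ 2 / 2) = 2 := by
  have h := integral_rpow_mul_exp_neg_mul_rpow (p := 2) (q := 3) (b := 1 / 2)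
    (by norm_num) (by norm_num) (by norm_num)
  rw [show ((3 : ℝ) + 1) / 2 = 2 by norm_num, Real.Gamma_two,
    show -((3 : ℝ) + 1) / 2 = ((-2 : ℤ) : ℝ) by norm_num, Real.rpow_intCast] at h
  refine Eq.trans ?_ (h.trans (by norm_num))
  refine setIntegral_congr_fun measurableSet_Ioi fun r _ => ?_
  norm_cast
  ring_nf

lemma integral_relu_cos_mul_relu_cos_sub {θ : ℝ} (h0 : 0 ≤ θ) (hπ : θ ≤ π) :
    ∫ φ in Set.Ioo (-π) π, max 0 (cos φ) * max 0 (cos (φ - θ))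
      = (sin θ + (π - θ) * cos θ) / 2 := by
  have hpi := Real.pi_pos
  have hcos {x : ℝ} (h1 : π / 2 ≤ x) (h2 : x ≤ 3 * π / 2) : cos x ≤ 0 :=
    Real.cos_nonpos_of_pi_div_two_le_of_le h1 (by linarith)
  have hsub : Set.Ioo (θ - π / 2) (π / 2) ⊆ Set.Ioo (-π) π :=
    Set.Ioo_subset_Ioo (by linarith) (by linarith)
  rw [setIntegral_eq_of_subset_of_forall_sdiff_eq_zero measurableSet_Ioo hsub]
  · rw [setIntegral_congr_fun (g := fun φ => cos φ * cos (φ - θ)) measurableSet_Ioo,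
      ← integral_Ioc_eq_integral_Ioo, ← intervalIntegral.integral_of_le (by linarith)]
    · have hderiv (x : ℝ) : HasDerivAt (fun φ => (φ * cos θ + sin (2 * φ - θ) / 2) / 2)
          (cos x * cos (x - θ)) x := by
        have h := ((((hasDerivAt_id x).const_mul 2).sub_const θ).sin.div_const 2)
        refine ((((hasDerivAt_id x).mul_const (cos θ)).add h).div_const 2).congr_deriv ?_
        have e1 : cos θ = cos (x - (x - θ)) := by ring_nf
        have e2 : cos (2 * x - θ) = cos (x + (x - θ)) := by ring_nf
        simp only [id]
        rw [e2, e1, cos_sub x (x - θ), cos_add x (x - θ)]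
        ring
      rw [intervalIntegral.integral_eq_sub_of_hasDerivAt (fun x _ => hderiv x)
        (Continuous.intervalIntegrable (by fun_prop) _ _)]
      rw [show 2 * (π / 2) - θ = π - θ by ring, show 2 * (θ - π / 2) - θ = -(π - θ) by ring,
        sin_neg, sin_pi_sub]
      ring
    · intro φ hφ
      have h1 : 0 ≤ cos φ := cos_nonneg_of_mem_Icc ⟨by linarith [hφ.1], hφ.2.le⟩
      have h2 : 0 ≤ cos (φ - θ) :=
        cos_nonneg_of_mem_Icc ⟨by linarith [hφ.1], by linarith [hφ.2]⟩
      simp only [max_eq_right h1, max_eq_right h2]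
  · rintro φ ⟨hφ, hn⟩
    rcases le_or_gt (π / 2) φ with h | h
    · rw [max_eq_left (hcos h (by linarith [hφ.2])), zero_mul]
    rcases le_or_gt φ (-(π / 2)) with h' | h'
    · rw [← cos_neg, max_eq_left (hcos (by linarith) (by linarith [hφ.1])), zero_mul]
    have h3 : φ ≤ θ - π / 2 := by
      by_contra! hc
      exact hn ⟨hc, h⟩
    have h4 : cos (-(φ - θ)) ≤ 0 := hcos (by linarith) (by linarith)
    rw [← cos_neg (φ - θ), max_eq_left h4, mul_zero]

lemma integral_relu_mul_relu_prod_gaussianReal {θ : ℝ} (h0 : 0 ≤ θ) (hπ : θ ≤ π) :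
    ∫ p : ℝ × ℝ, max 0 p.1 * max 0 (cos θ * p.1 + sin θ * p.2)
        ∂(gaussianReal 0 1).prod (gaussianReal 0 1)
      = (sin θ + (π - θ) * cos θ) / (2 * π) := by
  rw [integral_prod_gaussianReal, ← integral_comp_polarCoord_symm, polarCoord_target]
  have hpolar : Set.EqOn
      (fun p : ℝ × ℝ => p.1 • ((2 * π)⁻¹
        * rexp (-((polarCoord.symm p).1 ^ 2 + (polarCoord.symm p).2 ^ 2) / 2)
        * (max 0 (polarCoord.symm p).1
          * max 0 (cos θ * (polarCoord.symm p).1 + sin θ * (polarCoord.symm p).2))))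
      (fun p => (2 * π)⁻¹ * (p.1 ^ 3 * rexp (-p.1 ^ 2 / 2))
        * (max 0 (cos p.2) * max 0 (cos (p.2 - θ))))
      (Set.Ioi 0 ×ˢ Set.Ioo (-π) π) := by
    rintro ⟨r, φ⟩ ⟨hr, -⟩
    have hr : 0 ≤ r := le_of_lt hr
    have e1 : (r * cos φ) ^ 2 + (r * sin φ) ^ 2 = r ^ 2 := by
      linear_combination r ^ 2 * cos_sq_add_sin_sq φ
    have e2 : cos θ * (r * cos φ) + sin θ * (r * sin φ) = r * cos (φ - θ) := by
      rw [cos_sub]; ring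
    have hmax (x : ℝ) : max 0 (r * x) = r * max 0 x := by
      rw [mul_max_of_nonneg _ _ hr, mul_zero]
    simp only [polarCoord_symm_apply, smul_eq_mul, e1, e2, hmax]
    ring
  rw [setIntegral_congr_fun (measurableSet_Ioi.prod measurableSet_Ioo) hpolar,
    Measure.volume_eq_prod,
    setIntegral_prod_mul (fun r => (2 * π)⁻¹ * (r ^ 3 * rexp (-r ^ 2 / 2)))
      (fun φ => max 0 (cos φ) * max 0 (cos (φ - θ))),
    integral_const_mul, integral_pow_three_mul_exp_neg_sq_div_two,
    integral_relu_cos_mul_relu_cos_sub h0 hπ]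
  field_simp

/-- If `(z₁, z₂)` is a centered bivariate Gaussian random vector
(encoded by its law `μ` on `ℝ²`: every linear functional `a z₁ + b z₂` has the
centered Gaussian law with variance `a²σ₁² + 2abρσ₁σ₂ + b²σ₂²`) with variances
`σ₁², σ₂²` (`σ₁, σ₂ > 0`) and correlation `ρ ∈ [−1,1]`, then
`E[relu(z₁) relu(z₂)] = (σ₁σ₂/(2π)) (sin(arccos ρ) + (π − arccos ρ) ρ)`. -/
theorem stmt4 (σ₁ σ₂ ρ : ℝ) (hσ₁ : 0 < σ₁) (hσ₂ : 0 < σ₂)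
    (hρ₁ : -1 ≤ ρ) (hρ₂ : ρ ≤ 1)
    (μ : Measure (Fin 2 → ℝ)) (hμ : IsProbabilityMeasure μ)
    (hGauss : ∀ a b : ℝ,
      μ.map (fun z => a * z 0 + b * z 1) =
        gaussianReal 0 (Real.toNNReal
          (a ^ 2 * σ₁ ^ 2 + 2 * a * b * ρ * σ₁ * σ₂ + b ^ 2 * σ₂ ^ 2))) :
    (∫ z, max 0 (z 0) * max 0 (z 1) ∂μ)
      = (σ₁ * σ₂ / (2 * π)) *
        (Real.sin (Real.arccos ρ) + (π - Real.arccos ρ) * ρ) := by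
  have hcos : cos (arccos ρ) = ρ := cos_arccos hρ₁ hρ₂
  have hT : Measurable (fun p : ℝ × ℝ =>
      ![σ₁ * p.1, σ₂ * (cos (arccos ρ) * p.1 + sin (arccos ρ) * p.2)]) := by
    refine measurable_pi_iff.2 fun i => ?_
    fin_cases i <;> simp <;> fun_prop
  have hμ_eq : μ = ((gaussianReal 0 1).prod (gaussianReal 0 1)).map (fun p : ℝ × ℝ =>
      ![σ₁ * p.1, σ₂ * (cos (arccos ρ) * p.1 + sin (arccos ρ) * p.2)]) := by
    have := Measure.isProbabilityMeasure_map
      (μ := (gaussianReal 0 1).prod (gaussianReal 0 1)) hT.aemeasurable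
    refine measure_fin_two_ext_of_map_linear fun a b => ?_
    have hlin : (fun z : Fin 2 → ℝ => a * z 0 + b * z 1) ∘ (fun p : ℝ × ℝ =>
          ![σ₁ * p.1, σ₂ * (cos (arccos ρ) * p.1 + sin (arccos ρ) * p.2)])
        = fun p => (a * σ₁ + b * σ₂ * cos (arccos ρ)) * p.1
          + (b * σ₂ * sin (arccos ρ)) * p.2 := by
      ext p
      simp only [Function.comp_apply, Matrix.cons_val_zero, Matrix.cons_val_one]
      ring
    rw [hGauss, Measure.map_map (by fun_prop) hT, hlin, map_linear_prod_gaussianReal]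
    congr 2
    linear_combination (-(b * σ₂) ^ 2) * sin_sq_add_cos_sq (arccos ρ)
      - 2 * a * b * σ₁ * σ₂ * hcos
  have hmax {c : ℝ} (hc : 0 < c) (x : ℝ) : max 0 (c * x) = c * max 0 x := by
    rw [mul_max_of_nonneg _ _ hc.le, mul_zero]
  rw [hμ_eq, integral_map hT.aemeasurable
    (Measurable.aestronglyMeasurable (by fun_prop))]
  simp only [Matrix.cons_val_zero, Matrix.cons_val_one, hmax hσ₁, hmax hσ₂, mul_mul_mul_comm σ₁]
  rw [integral_const_mul,
    integral_relu_mul_relu_prod_gaussianReal (arccos_nonneg ρ) (arccos_le_pi ρ), hcos]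
  ring
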